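/- arXiv:2603.10728 — 5 statements merged into one kernel-verified Lean document; each statement's English description precedes it below -/
import Mathlib

section
/- For all integers A and B, h̃_A · h̃_B − h̃_{A−1} · h̃_{B−1} = h̃_{A+B} in V. -/
open Finsupp

/-- `V` is the free ℤ-module with basis indexed by ℤ (finitely supported functions ℤ → ℤ). -/
abbrev V : Type := ℤ →₀ ℤ

/-- The basis element `h̃_j`. -/
noncomputable def ht (j : ℤ) : V := Finsupp.single j 1

/-- The product of two basis elements `h̃_A · h̃_B`:
`∑_{j=0}^{A} h̃_{B−A+2j}` for `A ≥ 0`; `0` for `A = −1`; `−(h̃_{−A−2} · h̃_B)` for `A ≤ −2`. -/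
noncomputable def basicMul (A B : ℤ) : V :=
  if 0 ≤ A then ∑ j ∈ Finset.range (A.toNat + 1), ht (B - A + 2 * (j : ℤ))
  else if A = -1 then 0
  else - ∑ j ∈ Finset.range ((-A - 2).toNat + 1), ht (B - (-A - 2) + 2 * (j : ℤ))

/-- The ℤ-bilinear product on `V` extending `basicMul` on basis elements. -/
noncomputable def mulV (g₁ g₂ : V) : V :=
  g₁.sum fun A cA => g₂.sum fun B cB => (cA * cB) • basicMul A B

/-- The shift operator `S_k`, with `S_k(h̃_j) = h̃_{j+k}`. -/
noncomputable def S (k : ℤ) (g : V) : V := Finsupp.mapDomain (fun j => j + k) g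

/-- Value of the map `L` on the basis element `h̃_j`. -/
noncomputable def Lb (j : ℤ) : V :=
  if 0 ≤ j then ht j else if j = -1 then 0 else - ht (-j - 2)

/-- The ℤ-linear map `L : V → V` with `L(h̃_j) = h̃_j` for `j ≥ 0`,
`L(h̃_{−1}) = 0`, `L(h̃_j) = −h̃_{−j−2}` for `j ≤ −2`. -/
noncomputable def Lmap (g : V) : V := g.sum fun j c => c • Lb j

/-- `W₀(g₁,g₂,g₃) = g₂ · (g₁ · g₃ − S_{−1}(g₁) · S_{−1}(g₃))`. -/
noncomputable def W0 (g₁ g₂ g₃ : V) : V :=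
  mulV g₂ (mulV g₁ g₃ - mulV (S (-1) g₁) (S (-1) g₃))

/-- `W₁(g₁,g₂,g₃) = S_{−1}(g₁)·g₂·g₃ + g₁·g₂·S_{−1}(g₃) − S_{−1}(g₁)·g₂·S_{−1}(g₃)`
(products associated to the left). -/
noncomputable def W1 (g₁ g₂ g₃ : V) : V :=
  mulV (mulV (S (-1) g₁) g₂) g₃ + mulV (mulV g₁ g₂) (S (-1) g₃)
    - mulV (mulV (S (-1) g₁) g₂) (S (-1) g₃)

/-- The multiset (Minkowski) sum `M₁ + M₂ = {i₁ + i₂ : i₁ ∈ M₁, i₂ ∈ M₂}`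
counted with multiplicity. -/
def msAdd (M₁ M₂ : Multiset ℤ) : Multiset ℤ := M₁.bind fun a => M₂.map fun b => a + b

/-- The multiset `[a, b] = {a, a+2, …, b−2, b}` (for `a ≤ b` with `a ≡ b (mod 2)`). -/
def iv (a b : ℤ) : Multiset ℤ :=
  (Multiset.range (((b - a) / 2).toNat + 1)).map fun j => a + 2 * (j : ℤ)

/-- `R(c)`: the set of finite multisets `M` of integers with
`mult(c−i−1, M) ≤ mult(c−i, M) ≤ mult(c+i, M)` for all `i ≥ 0`. -/
def Rset (c : ℤ) : Set (Multiset ℤ) :=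
  {M | ∀ i : ℤ, 0 ≤ i →
    M.count (c - i - 1) ≤ M.count (c - i) ∧ M.count (c - i) ≤ M.count (c + i)}

/-- `h̃(M) = ∑_{i ∈ ℤ} mult(i, M) · h̃_i ∈ V`. -/
noncomputable def hMS (M : Multiset ℤ) : V := (M.map ht).sum

/-- The triple `(ẽ(n,0,0), ẽ(n,1,0), ẽ(n,−1,0))`. -/
noncomputable def eZ : ℕ → V × V × V
  | 0 => (ht 2, ht 1, ht 1)
  | n + 1 =>
    let e0 := (eZ n).1
    let e1 := (eZ n).2.1
    let em := (eZ n).2.2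
    (mulV e0 (mulV e0 e0 - mulV e1 e1),
     mulV (mulV e1 e0) e0 + mulV (mulV e0 e0) e1
       - mulV (mulV (mulV e1 (ht 1)) e0) e1,
     mulV (mulV e1 e0) e0 + mulV (mulV e0 e0) e1
       - mulV (mulV (mulV e1 (ht 1)) e0) e1
       + mulV (mulV em em) (em - e1))

/-- The triple `(ẽ(n,0,1), ẽ(n,1,1), ẽ(n,−1,1))`. -/
noncomputable def eO : ℕ → V × V × V
  | 0 => (0, 0, ht 0)
  | n + 1 =>
    let e0 := (eZ n).1
    let e1 := (eO n).1
    let o1 := (eO n).2.1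
    let om := (eO n).2.2
    (W0 e0 e0 (e1 + S (-1) e0) + W0 e0 e1 e0 + W0 e1 e0 e0,
     W1 e0 e0 (e1 + S (-1) e0) + W1 e0 e1 e0 + W1 e1 e0 e0,
     W1 e0 e0 (e1 + S (-1) e0) + W1 e0 e1 e0
       + mulV (mulV om e0) e0 + mulV (mulV e1 e0) (S (-1) e0)
       - mulV (mulV (mulV om (ht 1)) e0) (S (-1) e0)
       + (2 : ℤ) • mulV (mulV (S (-1) e0) e0) (S (-1) e0)
       - mulV (mulV (mulV (S (-1) e0) (ht 1)) (S (-1) e0)) (S (-1) e0)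
       + mulV (mulV (S (-1) e0) (om - o1)) (S (-1) e0))

/-- `ẽ(n, i, 0)` for `i ∈ {−1, 0, 1}`. -/
noncomputable def etilde0 (n : ℕ) (i : ℤ) : V :=
  if i = 0 then (eZ n).1 else if i = 1 then (eZ n).2.1 else (eZ n).2.2

/-- `ẽ(n, i, 1)` for `i ∈ {−1, 0, 1}`. -/
noncomputable def etilde1 (n : ℕ) (i : ℤ) : V :=
  if i = 0 then (eO n).1 else if i = 1 then (eO n).2.1 else (eO n).2.2

theorem mulV_ht_ht (A B : ℤ) : mulV (ht A) (ht B) = basicMul A B := by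
  simp [mulV, ht]

theorem basicMul_natCast_sub_one (n : ℕ) (B : ℤ) :
    basicMul (n - 1) B = ∑ j ∈ Finset.range n, ht (B - n + 1 + 2 * (j : ℤ)) := by
  cases n with
  | zero => simp [basicMul]
  | succ n =>
    rw [basicMul, if_pos (by omega), show ((n + 1 : ℕ) - 1 : ℤ).toNat = n by omega]
    refine Finset.sum_congr rfl fun j _ => congrArg ht ?_
    omega

theorem basicMul_neg_natCast_sub_one (n : ℕ) (B : ℤ) :
    basicMul (-n - 1) B = -∑ j ∈ Finset.range n, ht (B - n + 1 + 2 * (j : ℤ)) := by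
  cases n with
  | zero => simp [basicMul]
  | succ n =>
    rw [basicMul, if_neg (by omega), if_neg (by omega),
      show (-(-(n + 1 : ℕ) - 1) - 2 : ℤ).toNat = n by omega]
    refine congrArg Neg.neg (Finset.sum_congr rfl fun j _ => congrArg ht ?_)
    omega

/-- For all integers `A` and `B`, `h̃_A · h̃_B − h̃_{A−1} · h̃_{B−1} = h̃_{A+B}` in `V`. -/
theorem stmt0 (A B : ℤ) :
    mulV (ht A) (ht B) - mulV (ht (A - 1)) (ht (B - 1)) = ht (A + B) := by
  rw [mulV_ht_ht, mulV_ht_ht]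
  rcases lt_or_ge A 0 with hA | hA
  · obtain ⟨n, rfl⟩ : ∃ n : ℕ, A = -n - 1 := ⟨(-A - 1).toNat, by omega⟩
    rw [basicMul_neg_natCast_sub_one,
      show (-n - 1 - 1 : ℤ) = -((n + 1 : ℕ) : ℤ) - 1 by omega,
      basicMul_neg_natCast_sub_one, Finset.sum_range_succ', neg_sub_neg, add_sub_right_comm,
      sub_eq_zero.mpr, zero_add]
    · exact congrArg ht (by push_cast; ring)
    · refine Finset.sum_congr rfl fun j _ => congrArg ht ?_
      push_cast
      ring
  · obtain ⟨n, rfl⟩ := Int.eq_ofNat_of_zero_le hA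
    have h := basicMul_natCast_sub_one (n + 1) B
    rw [Nat.cast_succ, add_sub_cancel_right, Finset.sum_range_succ] at h
    rw [h, basicMul_natCast_sub_one, add_sub_right_comm, sub_eq_zero.mpr, zero_add]
    · exact congrArg ht (by ring)
    · refine Finset.sum_congr rfl fun j _ => congrArg ht ?_
      ring
end

section
/- For all integers A and B, h̃_A · h̃_B − h̃_{A−1} · h̃_{B+1} = h̃_{B−A} in V. -/
open Finsupp

theorem basicMul_natCast (n : ℕ) (B : ℤ) :
    basicMul n B = ∑ j ∈ Finset.range (n + 1), ht (B - n + 2 * (j : ℤ)) := by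
  simp [basicMul]

theorem basicMul_neg_one (B : ℤ) : basicMul (-1) B = 0 := by
  simp [basicMul]

theorem basicMul_neg_natCast_sub_two (n : ℕ) (B : ℤ) :
    basicMul (-(n : ℤ) - 2) B = -∑ j ∈ Finset.range (n + 1), ht (B - n + 2 * (j : ℤ)) := by
  have h₀ : ¬ (0 : ℤ) ≤ -(n : ℤ) - 2 := by lia
  have h₁ : -(n : ℤ) - 2 ≠ -1 := by lia
  have h₂ : -(-(n : ℤ) - 2) - 2 = n := by ring
  rw [basicMul, if_neg h₀, if_neg h₁, h₂, Int.toNat_natCast]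

/-- For all integers `A` and `B`, `h̃_A · h̃_B − h̃_{A−1} · h̃_{B+1} = h̃_{B−A}` in `V`. -/
theorem stmt1 (A B : ℤ) :
    mulV (ht A) (ht B) - mulV (ht (A - 1)) (ht (B + 1)) = ht (B - A) := by
  rw [mulV_ht_ht, mulV_ht_ht]
  obtain ⟨n, rfl⟩ | rfl | rfl | ⟨n, rfl⟩ :
      (∃ n : ℕ, A = ((n + 1 : ℕ) : ℤ)) ∨ A = 0 ∨ A = -1 ∨ ∃ n : ℕ, A = -(n : ℤ) - 2 := by
    rcases lt_or_ge 0 A with h | h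
    · exact Or.inl ⟨(A - 1).toNat, by lia⟩
    · by_cases h₀ : A = 0
      · exact Or.inr (Or.inl h₀)
      · by_cases h₁ : A = -1
        · exact Or.inr (Or.inr (Or.inl h₁))
        · exact Or.inr (Or.inr (Or.inr ⟨(-A - 2).toNat, by lia⟩))
  · have h : ((n + 1 : ℕ) : ℤ) - 1 = n := by push_cast; ring
    rw [h, basicMul_natCast, basicMul_natCast, Finset.sum_range_succ', add_sub_right_comm,
      ← Finset.sum_sub_distrib, Finset.sum_eq_zero, zero_add]
    · simp
    · intro j _
      rw [sub_eq_zero]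
      congr 1
      push_cast
      ring
  · rw [zero_sub, basicMul_neg_one, ← Nat.cast_zero, basicMul_natCast]
    simp
  · have h : (-1 : ℤ) - 1 = -((0 : ℕ) : ℤ) - 2 := by norm_num
    rw [h, basicMul_neg_one, basicMul_neg_natCast_sub_two]
    simp
  · have h : -(n : ℤ) - 2 - 1 = -((n + 1 : ℕ) : ℤ) - 2 := by push_cast; ring
    have hs : B + 1 - ((n + 1 : ℕ) : ℤ) = B - n := by push_cast; ring
    have he : B - (n : ℤ) + 2 * ((n + 1 : ℕ) : ℤ) = B - (-(n : ℤ) - 2) := by push_cast; ring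
    rw [h, basicMul_neg_natCast_sub_two, basicMul_neg_natCast_sub_two, hs,
      Finset.sum_range_succ _ (n + 1), he]
    abel
end

section
/- For all integers A₁, B and A₂, h̃_{A₁} · h̃_B · h̃_{A₂−1} + h̃_{A₁−1} · h̃_B · h̃_{A₂} − h̃_{A₁−1} · h̃₁ · h̃_B · h̃_{A₂−1} = h̃_B · h̃_{A₁+A₂−1} in V. -/
open Finsupp

open LaurentPolynomial in
/-- The identification of `V` with Laurent polynomials, `h̃_j ↦ T ^ j`. -/
noncomputable def toLaurent : V →ₗ[ℤ] ℤ[T;T⁻¹] :=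
  Finsupp.lsum ℤ fun j => LinearMap.toSpanSingleton ℤ ℤ[T;T⁻¹] (T j)

open LaurentPolynomial in
/-- The character map `V → ℤ[T;T⁻¹]`, sending `h̃_A` to the Laurent polynomial by which
`h̃_A` acts on the left. -/
noncomputable def character : V →ₗ[ℤ] ℤ[T;T⁻¹] :=
  Finsupp.lsum ℤ fun A => LinearMap.toSpanSingleton ℤ ℤ[T;T⁻¹] (toLaurent (basicMul A 0))

open LaurentPolynomial in
theorem toLaurent_single (j c : ℤ) : toLaurent (Finsupp.single j c) = c • T j := by
  simp [toLaurent]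

open LaurentPolynomial in
theorem toLaurent_ht (j : ℤ) : toLaurent (ht j) = T j := by
  simp [ht, toLaurent_single]

theorem character_ht (A : ℤ) : character (ht A) = toLaurent (basicMul A 0) := by
  simp [ht, character]

theorem character_single (A c : ℤ) :
    character (Finsupp.single A c) = c • character (ht A) := by
  simp [ht, character]

theorem toLaurent_injective : Function.Injective toLaurent := by
  have key : ∀ (v : V) (k : ℤ), (toLaurent v).coeff k = v k := by
    intro v k
    induction v using Finsupp.induction_linear with
    | zero => simp
    | add f g hf hg => simp [hf, hg]
    | single j c =>
      rw [toLaurent_single]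
      rw [LaurentPolynomial.T, AddMonoidAlgebra.coeff_smul, AddMonoidAlgebra.coeff_single]
      simp
  intro v w h
  ext k
  rw [← key v, ← key w, h]

open LaurentPolynomial in
theorem T_sub_T_ne_zero : (T 1 - T (-1) : ℤ[T;T⁻¹]) ≠ 0 := by
  intro h
  have h' : toLaurent (ht 1) = toLaurent (ht (-1)) := by
    rw [toLaurent_ht, toLaurent_ht]; exact sub_eq_zero.mp h
  have := DFunLike.congr_fun (toLaurent_injective h') 1
  simp [ht] at this

open LaurentPolynomial in
theorem T_sub_T_mul_sum_range (B : ℤ) (n : ℕ) :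
    (T 1 - T (-1) : ℤ[T;T⁻¹]) * ∑ j ∈ Finset.range (n + 1), T (B - n + 2 * (j : ℤ))
      = T (B + n + 1) - T (B - n - 1) := by
  have h : ∀ (C : ℤ) (m : ℕ),
      (T 1 - T (-1) : ℤ[T;T⁻¹]) * ∑ j ∈ Finset.range m, T (C + 2 * (j : ℤ))
        = T (C + 2 * m - 1) - T (C - 1) := by
    intro C m
    induction m with
    | zero => simp
    | succ m ih =>
      rw [Finset.sum_range_succ, mul_add, ih, sub_mul, ← T_add, ← T_add]
      push_cast
      ring_nf
  rw [h]
  push_cast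
  ring_nf

open LaurentPolynomial in
theorem T_sub_T_mul_toLaurent_basicMul (A B : ℤ) :
    (T 1 - T (-1)) * toLaurent (basicMul A B) = T (B + A + 1) - T (B - A - 1) := by
  unfold basicMul
  split_ifs with h₀ h₁
  · lift A to ℕ using h₀
    simp only [Int.toNat_natCast, map_sum, toLaurent_ht]
    exact T_sub_T_mul_sum_range B A
  · subst h₁
    simp
  · obtain ⟨n, hn⟩ := Int.eq_ofNat_of_zero_le (show 0 ≤ -A - 2 by omega)
    obtain rfl : A = -n - 2 := by omega
    rw [hn]
    simp only [Int.toNat_natCast, map_neg, map_sum, toLaurent_ht, mul_neg,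
      T_sub_T_mul_sum_range]
    ring_nf

open LaurentPolynomial in
theorem toLaurent_basicMul (A B : ℤ) :
    toLaurent (basicMul A B) = character (ht A) * T B := by
  apply mul_left_cancel₀ T_sub_T_ne_zero
  rw [character_ht, ← mul_assoc, T_sub_T_mul_toLaurent_basicMul,
    T_sub_T_mul_toLaurent_basicMul, sub_mul, ← T_add, ← T_add]
  ring_nf

theorem toLaurent_mulV (v w : V) : toLaurent (mulV v w) = character v * toLaurent w := by
  unfold mulV
  conv_rhs => rw [← Finsupp.sum_single v, ← Finsupp.sum_single w]
  simp only [Finsupp.sum, map_sum, map_smul, toLaurent_basicMul, Finset.sum_mul_sum,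
    character_single, toLaurent_single, smul_mul_smul_comm]

open LaurentPolynomial in
theorem T_sub_T_mul_character (v : V) :
    (T 1 - T (-1)) * character v
      = T 1 * toLaurent v - T (-1) * invert (toLaurent v) := by
  induction v using Finsupp.induction_linear with
  | zero => simp
  | add f g hf hg => simp only [map_add, mul_add, hf, hg]; ring
  | single A c =>
    rw [character_single, character_ht, toLaurent_single, mul_smul_comm, T_sub_T_mul_toLaurent_basicMul,
      map_zsmul, invert_T, mul_smul_comm, mul_smul_comm, ← smul_sub, ← T_add, ← T_add]
    ring_nf

open LaurentPolynomial in
theorem invert_character (v : V) : invert (character v) = character v := by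
  apply mul_left_cancel₀ T_sub_T_ne_zero
  have h := T_sub_T_mul_character v
  have h' := congrArg invert h
  simp only [map_mul, map_sub, invert_T, neg_neg] at h'
  rw [show invert (invert (toLaurent v)) = toLaurent v from invert.left_inv _] at h'
  linear_combination -h' - h

open LaurentPolynomial in
theorem character_mulV (v w : V) : character (mulV v w) = character v * character w := by
  apply mul_left_cancel₀ T_sub_T_ne_zero
  rw [T_sub_T_mul_character, toLaurent_mulV, map_mul, invert_character]
  linear_combination -character v * T_sub_T_mul_character w

open LaurentPolynomial in
theorem character_ht_sub (A : ℤ) :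
    character (ht A) - T (-1) * character (ht (A - 1)) = T A := by
  apply mul_left_cancel₀ T_sub_T_ne_zero
  rw [mul_sub, mul_left_comm, character_ht, character_ht, T_sub_T_mul_toLaurent_basicMul,
    T_sub_T_mul_toLaurent_basicMul, mul_sub, sub_mul, ← T_add, ← T_add, ← T_add, ← T_add]
  ring_nf

open LaurentPolynomial in
theorem character_ht_one : character (ht 1) = T 1 + T (-1) := by
  simp [character_ht, basicMul, Finset.sum_range_succ, toLaurent_ht, add_comm]

/-- For all integers `A₁, B, A₂`,
`h̃_{A₁}·h̃_B·h̃_{A₂−1} + h̃_{A₁−1}·h̃_B·h̃_{A₂} − h̃_{A₁−1}·h̃₁·h̃_B·h̃_{A₂−1}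
 = h̃_B·h̃_{A₁+A₂−1}` in `V`. -/
theorem stmt3 (A₁ B A₂ : ℤ) :
    mulV (mulV (ht A₁) (ht B)) (ht (A₂ - 1))
      + mulV (mulV (ht (A₁ - 1)) (ht B)) (ht A₂)
      - mulV (mulV (mulV (ht (A₁ - 1)) (ht 1)) (ht B)) (ht (A₂ - 1))
      = mulV (ht B) (ht (A₁ + A₂ - 1)) := by
  apply toLaurent_injective
  simp only [map_add, map_sub, toLaurent_mulV, character_mulV, toLaurent_ht, character_ht_one]
  have h₁ : (LaurentPolynomial.T A₂ : LaurentPolynomial ℤ)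
      = LaurentPolynomial.T 1 * LaurentPolynomial.T (A₂ - 1) := by
    rw [← LaurentPolynomial.T_add]; ring_nf
  have h₂ : (LaurentPolynomial.T (A₁ + A₂ - 1) : LaurentPolynomial ℤ)
      = LaurentPolynomial.T A₁ * LaurentPolynomial.T (A₂ - 1) := by
    rw [← LaurentPolynomial.T_add]; ring_nf
  rw [h₁, h₂]
  linear_combination
    character (ht B) * LaurentPolynomial.T (A₂ - 1) * character_ht_sub A₁
end

section
/- For all integers c₁, c₂, if M₁ ∈ R(c₁) and M₂ ∈ R(c₂), then the multiset sum M₁ + M₂ belongs to R(c₁ + c₂). -/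
open Finsupp

theorem Rset_add {c : ℤ} {M N : Multiset ℤ} (hM : M ∈ Rset c) (hN : N ∈ Rset c) :
    M + N ∈ Rset c := by
  intro i hi
  have h := hM i hi
  have h' := hN i hi
  simp only [Multiset.count_add]
  omega

theorem Rset_count_mono {c : ℤ} {M : Multiset ℤ} (hM : M ∈ Rset c) {x y : ℤ}
    (hxy : x ≤ y) (hy : y ≤ c) : M.count x ≤ M.count y := by
  induction y, hxy using Int.leInduction with
  | base => exact le_rfl
  | succ n _ ih =>
    have h := (hM (c - (n + 1)) (by omega)).1
    rw [show c - (c - (n + 1)) - 1 = n by ring, show c - (c - (n + 1)) = n + 1 by ring] at h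
    exact (ih (by omega)).trans h

/-- Multiplicity in `M ∈ R(c)` does not decrease from `x` to any `y` with `x ≤ y ≤ 2c − x`. -/
theorem Rset_count_le {c : ℤ} {M : Multiset ℤ} (hM : M ∈ Rset c) {x y : ℤ}
    (hxy : x ≤ y) (h : x + y ≤ 2 * c) : M.count x ≤ M.count y := by
  rcases le_or_gt y c with hy | hy
  · exact Rset_count_mono hM hxy hy
  · have h' := (hM (y - c) (by omega)).2
    rw [show c + (y - c) = y by ring] at h'
    exact (Rset_count_mono hM (by omega) (by omega)).trans h'

/-- Every multiset in `R(c)` is a sum of points `k ≥ c` and intervals centred at `c`. -/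
theorem Rset_induction {c : ℤ} {P : Multiset ℤ → Prop} (zero : P 0)
    (point : ∀ k M, c ≤ k → P M → P ({k} + M))
    (interval : ∀ a M, 0 ≤ a → P M → P ((Finset.Icc (c - a) (c + a)).val + M))
    {M : Multiset ℤ} (hM : M ∈ Rset c) : P M := by
  induction hn : M.card using Nat.strong_induction_on generalizing M with
  | _ n ih =>
  rcases eq_or_ne M 0 with rfl | hne
  · exact zero
  have hne' : M.toFinset.Nonempty := Multiset.toFinset_nonempty.2 hne
  obtain ⟨m, hm, hmin⟩ := M.toFinset.exists_min_image id hne'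
  simp only [Multiset.mem_toFinset, id] at hm hmin
  have hlt : ∀ x < m, M.count x = 0 := fun x hx =>
    Multiset.count_eq_zero.2 fun h => absurd (hmin x h) (by omega)
  have hpos := Multiset.count_pos.2 hm
  rcases le_or_gt m c with hmc | hmc
  · have hIcc : (Finset.Icc (c - (c - m)) (c + (c - m))).val ≤ M := by
      rw [Finset.val_le_iff_val_subset]
      intro x hx
      rw [Finset.mem_val, Finset.mem_Icc] at hx
      exact Multiset.count_pos.1 (hpos.trans_le (Rset_count_le hM (by omega) (by omega)))
    obtain ⟨N, rfl⟩ := Multiset.le_iff_exists_add.1 hIcc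
    refine interval _ _ (by omega) (ih N.card ?_ ?_ rfl)
    · have : 0 < (Finset.Icc (c - (c - m)) (c + (c - m))).card :=
        Finset.card_pos.2 ⟨m, by rw [Finset.mem_Icc]; omega⟩
      rw [Multiset.card_add, Finset.card_val] at hn
      omega
    · intro i hi
      have h := hM i hi
      have h0 := hlt (c - i - 1)
      simp only [Multiset.count_add,
        Multiset.count_eq_of_nodup (Finset.nodup _), Finset.mem_val, Finset.mem_Icc] at h h0
      split_ifs at h h0 <;> omega
  · obtain ⟨N, rfl⟩ := Multiset.le_iff_exists_add.1 (Multiset.singleton_le.2 hm)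
    refine point _ _ hmc.le (ih N.card ?_ ?_ rfl)
    · rw [Multiset.card_add, Multiset.card_singleton] at hn
      omega
    · intro i hi
      have h0 := hlt (c - i - 1) (by omega)
      have h1 := hlt (c - i) (by omega)
      rw [Multiset.count_add] at h0 h1
      omega

theorem count_msAdd (M N : Multiset ℤ) (x : ℤ) :
    (msAdd M N).count x = (M.map fun k => N.count (x - k)).sum := by
  rw [msAdd, Multiset.count_bind]
  congr 1
  refine Multiset.map_congr rfl fun k _ => ?_
  have h := Multiset.count_map_eq_count' (fun b => k + b) N (add_right_injective k) (x - k)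
  simpa using h

theorem msAdd_point_mem_Rset {c d k : ℤ} (hk : c ≤ k) {N : Multiset ℤ} (hN : N ∈ Rset d) :
    msAdd {k} N ∈ Rset (c + d) := by
  intro i hi
  simp only [count_msAdd, Multiset.map_singleton, Multiset.sum_singleton]
  exact ⟨Rset_count_le hN (by omega) (by omega), Rset_count_le hN (by omega) (by omega)⟩

theorem count_msAdd_Icc (c a x : ℤ) (N : Multiset ℤ) :
    (msAdd (Finset.Icc (c - a) (c + a)).val N).count x
      = ∑ y ∈ Finset.Icc (x - c - a) (x - c + a), N.count y := by
  rw [count_msAdd]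
  change ∑ k ∈ Finset.Icc (c - a) (c + a), N.count (x - k) = _
  refine Finset.sum_nbij' (fun k => x - k) (fun y => x - y) ?_ ?_ ?_ ?_ ?_ <;>
    simp only [Finset.mem_Icc] <;> intros <;> first | trivial | omega

theorem msAdd_Icc_mem_Rset {c d a : ℤ} (ha : 0 ≤ a) {N : Multiset ℤ} (hN : N ∈ Rset d) :
    msAdd (Finset.Icc (c - a) (c + a)).val N ∈ Rset (c + d) := by
  intro i hi
  simp only [count_msAdd_Icc]
  constructor
  · rw [← Finset.insert_Icc_add_one_left_eq_Icc (a := c + d - i - 1 - c - a) (by omega),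
      Finset.sum_insert (by simp),
      ← Finset.insert_Icc_sub_one_right_eq_Icc (a := c + d - i - c - a) (by omega),
      Finset.sum_insert (by simp)]
    have h : N.count (c + d - i - 1 - c - a) ≤ N.count (c + d - i - c + a) :=
      Rset_count_le hN (by omega) (by omega)
    rw [show c + d - i - 1 - c - a + 1 = c + d - i - c - a by ring,
      show c + d - i - 1 - c + a = c + d - i - c + a - 1 by ring]
    omega
  · rw [← Finset.sum_sdiff_le_sum_sdiff]
    refine (Finset.sum_le_sum fun y hy => ?_).trans_eq
      (Finset.sum_nbij' (g := fun y => N.count y) (f := fun y => N.count (2 * d - y))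
        (fun y => 2 * d - y) (fun y => 2 * d - y) ?_ ?_ ?_ ?_ ?_)
    · simp only [Finset.mem_sdiff, Finset.mem_Icc] at hy
      exact Rset_count_le hN (by omega) (by omega)
    all_goals simp only [Finset.mem_sdiff, Finset.mem_Icc]; intros; first | trivial | omega

/-- If `M₁ ∈ R(c₁)` and `M₂ ∈ R(c₂)` then the multiset sum `M₁ + M₂ ∈ R(c₁ + c₂)`. -/
theorem stmt8 (c₁ c₂ : ℤ) (M₁ M₂ : Multiset ℤ) (h₁ : M₁ ∈ Rset c₁) (h₂ : M₂ ∈ Rset c₂) :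
    msAdd M₁ M₂ ∈ Rset (c₁ + c₂) := by
  refine Rset_induction (c := c₁) (P := fun M => msAdd M M₂ ∈ Rset (c₁ + c₂))
    ?_ ?_ ?_ h₁
  · intro i _
    simp [msAdd]
  · intro k M hk hM
    rw [msAdd, Multiset.add_bind]
    exact Rset_add (msAdd_point_mem_Rset hk h₂) hM
  · intro a M ha hM
    rw [msAdd, Multiset.add_bind]
    exact Rset_add (msAdd_Icc_mem_Rset ha h₂) hM
end

section
/- For every integer n ≥ 0 and every i ∈ {−1, 0, 1}, every coefficient of L(ẽ(n, i, 0)) in the basis (h̃_j) is nonnegative; equivalently, for every j ≥ 0 the coefficient of h̃_j in ẽ(n, i, 0) is at least the coefficient of h̃_{−j−2} in ẽ(n, i, 0). -/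
open Finsupp

section ChebyshevPositivity

open Polynomial

/-- The Chebyshev polynomial `Sₙ` is monic of degree `n`. -/
theorem chebyshevS_natCast_degree_monic (n : ℕ) :
    (Chebyshev.S ℤ n).degree = n ∧ (Chebyshev.S ℤ n).Monic := by
  induction n using Nat.twoStepInduction with
  | zero => simp
  | one => simp [monic_X]
  | more n ih₀ ih₁ =>
    have hrec : Chebyshev.S ℤ ((n + 2 : ℕ) : ℤ) =
        Chebyshev.S ℤ ((n + 1 : ℕ) : ℤ) * X - Chebyshev.S ℤ n := by
      push_cast
      rw [Chebyshev.S_add_two, mul_comm]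
    have hdeg : (Chebyshev.S ℤ ((n + 1 : ℕ) : ℤ) * X).degree = ((n + 2 : ℕ) : WithBot ℕ) := by
      rw [degree_mul, ih₁.1, degree_X]
      norm_cast
    have hlt : (Chebyshev.S ℤ n).degree < (Chebyshev.S ℤ ((n + 1 : ℕ) : ℤ) * X).degree := by
      rw [hdeg, ih₀.1]
      exact_mod_cast (by omega : n < n + 2)
    rw [hrec]
    exact ⟨by rw [degree_sub_eq_left_of_degree_lt hlt, hdeg],
      (ih₁.2.mul monic_X).sub_of_left hlt⟩

/-- The sequence `S₀, S₁, …` of Chebyshev polynomials. -/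
noncomputable def chebyshevSequence : Polynomial.Sequence ℤ where
  elems' n := Chebyshev.S ℤ n
  degree_eq' n := (chebyshevS_natCast_degree_monic n).1

/-- The basis `S₀, S₁, …` of `ℤ[X]`. -/
noncomputable def chebyshevBasis : Module.Basis ℕ ℤ ℤ[X] :=
  chebyshevSequence.basis fun n => by
    have h : (chebyshevSequence n).Monic := (chebyshevS_natCast_degree_monic n).2
    simp [h.leadingCoeff]

theorem chebyshevBasis_apply (n : ℕ) : chebyshevBasis n = Chebyshev.S ℤ n :=
  chebyshevSequence.basis_eq_self _ n

theorem chebyshevBasis_repr_S (n : ℕ) :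
    chebyshevBasis.repr (Chebyshev.S ℤ n) = Finsupp.single n 1 := by
  rw [← chebyshevBasis_apply, Module.Basis.repr_self]

theorem chebyshevS_mul_sub_mul (a b : ℤ) :
    Chebyshev.S ℤ a * Chebyshev.S ℤ b - Chebyshev.S ℤ (a - 1) * Chebyshev.S ℤ (b - 1) =
      Chebyshev.S ℤ (a + b) := by
  induction a using Chebyshev.induct generalizing b with
  | zero => simp
  | one =>
    rw [add_comm, Chebyshev.S_add_one]
    simp
  | add_two n ih₁ ih₀ =>
    have h := Chebyshev.S_add_two ℤ (n + b)
    have h₁ := Chebyshev.S_add_two ℤ (n : ℤ)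
    have h₂ := Chebyshev.S_add_one ℤ (n : ℤ)
    have i₀ := ih₀ b
    have i₁ := ih₁ b
    rw [show (n : ℤ) + 1 - 1 = n by ring] at i₁
    rw [show (n : ℤ) + 2 - 1 = n + 1 by ring, show (n : ℤ) + 2 + b = n + b + 2 by ring, h, h₁,
      show (n : ℤ) + b + 1 = n + 1 + b by ring]
    linear_combination X * i₁ - i₀ - Chebyshev.S ℤ (b - 1) * h₂
  | neg_add_one n ih₀ ih₁ =>
    have h := Chebyshev.S_sub_one ℤ (-n + b)
    have h₁ := Chebyshev.S_sub_one ℤ (-n : ℤ)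
    have h₂ := Chebyshev.S_sub_two ℤ (-n : ℤ)
    have i₀ := ih₀ b
    have i₁ := ih₁ b
    rw [show -(n : ℤ) + 1 - 1 = -n by ring] at i₁
    rw [show -(n : ℤ) - 1 - 1 = -n - 2 by ring, show -(n : ℤ) - 1 + b = -n + b - 1 by ring, h,
      h₁, h₂, show -(n : ℤ) + b + 1 = -n + 1 + b by ring]
    linear_combination X * i₀ - i₁

theorem chebyshevS_mul_eq_sum (A : ℕ) (B : ℤ) :
    Chebyshev.S ℤ A * Chebyshev.S ℤ B =
      ∑ j ∈ Finset.range (A + 1), Chebyshev.S ℤ (B - A + 2 * (j : ℤ)) := by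
  induction A generalizing B with
  | zero => simp
  | succ A ih =>
    have h := chebyshevS_mul_sub_mul ((A + 1 : ℕ) : ℤ) B
    have hA : ((A + 1 : ℕ) : ℤ) - 1 = A := by push_cast; ring
    rw [hA, ih, sub_eq_iff_eq_add] at h
    rw [h, Finset.sum_range_succ _ (A + 1), add_comm]
    have hlast : ((A + 1 : ℕ) : ℤ) + B = B - (A + 1 : ℕ) + 2 * (A + 1 : ℕ) := by ring
    rw [hlast, add_left_inj]
    refine Finset.sum_congr rfl fun j _ => ?_
    rw [show B - 1 - A = B - (A + 1 : ℕ) by push_cast; ring]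

/-- A polynomial is Chebyshev-nonnegative if its coordinates in the basis `S₀, S₁, …` are
nonnegative. -/
def ChebyshevNonneg (p : ℤ[X]) : Prop := ∀ n, 0 ≤ chebyshevBasis.repr p n

theorem ChebyshevNonneg.add {p q : ℤ[X]} (hp : ChebyshevNonneg p) (hq : ChebyshevNonneg q) :
    ChebyshevNonneg (p + q) := fun n => by
  simpa using add_nonneg (hp n) (hq n)

theorem ChebyshevNonneg.smul {p : ℤ[X]} (hp : ChebyshevNonneg p) {c : ℤ} (hc : 0 ≤ c) :
    ChebyshevNonneg (c • p) := fun n => by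
  rw [map_smul]
  exact mul_nonneg hc (hp n)

theorem ChebyshevNonneg.sum {ι : Type*} {s : Finset ι} {f : ι → ℤ[X]}
    (hf : ∀ i ∈ s, ChebyshevNonneg (f i)) : ChebyshevNonneg (∑ i ∈ s, f i) :=
  Finset.sum_induction f ChebyshevNonneg (fun _ _ => .add) (fun n => by simp) hf

theorem chebyshevNonneg_S (n : ℕ) : ChebyshevNonneg (Chebyshev.S ℤ n) := fun m => by
  rw [chebyshevBasis_repr_S, Finsupp.single_apply]
  split_ifs <;> simp

theorem chebyshevNonneg_S_mul_S (a b : ℕ) :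
    ChebyshevNonneg (Chebyshev.S ℤ a * Chebyshev.S ℤ b) := by
  induction a generalizing b with
  | zero => simpa using chebyshevNonneg_S b
  | succ a ih =>
    cases b with
    | zero => simpa using chebyshevNonneg_S (a + 1)
    | succ b =>
      have h := chebyshevS_mul_sub_mul ((a + 1 : ℕ) : ℤ) ((b + 1 : ℕ) : ℤ)
      rw [sub_eq_iff_eq_add] at h
      rw [h]
      refine .add (by exact_mod_cast chebyshevNonneg_S (a + 1 + (b + 1))) ?_
      simpa using ih b

theorem ChebyshevNonneg.mul {p q : ℤ[X]} (hp : ChebyshevNonneg p) (hq : ChebyshevNonneg q) :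
    ChebyshevNonneg (p * q) := by
  rw [← chebyshevBasis.linearCombination_repr p, ← chebyshevBasis.linearCombination_repr q,
    Finsupp.linearCombination_apply, Finsupp.linearCombination_apply, Finsupp.sum, Finsupp.sum,
    Finset.sum_mul_sum]
  refine .sum fun a _ => .sum fun b _ => ?_
  rw [smul_mul_smul_comm, chebyshevBasis_apply, chebyshevBasis_apply]
  exact (chebyshevNonneg_S_mul_S a b).smul (mul_nonneg (hp a) (hq b))

/-- The linear map `V → ℤ[X]` with `h̃_j ↦ S_j`. -/
noncomputable def toChebyshev : V →ₗ[ℤ] ℤ[X] := Finsupp.linearCombination ℤ (Chebyshev.S ℤ)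

theorem toChebyshev_ht (j : ℤ) : toChebyshev (ht j) = Chebyshev.S ℤ j := by
  simp [toChebyshev, ht]

theorem toChebyshev_basicMul (A B : ℤ) :
    toChebyshev (basicMul A B) = Chebyshev.S ℤ A * Chebyshev.S ℤ B := by
  unfold basicMul
  split_ifs with h₀ h₁
  · lift A to ℕ using h₀
    rw [chebyshevS_mul_eq_sum]
    simp [toChebyshev_ht]
  · simp [h₁]
  · obtain ⟨k, hk⟩ := Int.eq_ofNat_of_zero_le (show 0 ≤ -A - 2 by omega)
    obtain rfl : A = -k - 2 := by omega
    rw [Chebyshev.S_neg_sub_two, neg_mul, chebyshevS_mul_eq_sum]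
    simp [toChebyshev_ht]

theorem toChebyshev_mulV (f g : V) :
    toChebyshev (mulV f g) = toChebyshev f * toChebyshev g := by
  have hlin (h : V) : toChebyshev h = ∑ j ∈ h.support, h j • Chebyshev.S ℤ j := rfl
  rw [hlin f, hlin g, Finset.sum_mul_sum]
  simp only [mulV, Finsupp.sum, map_sum, map_smul, toChebyshev_basicMul, smul_mul_smul_comm]

theorem Lb_apply (j k : ℤ) :
    Lb j k = if 0 ≤ k then chebyshevBasis.repr (Chebyshev.S ℤ j) k.toNat else 0 := by
  have hnat (n : ℕ) : ht n k =
      if 0 ≤ k then chebyshevBasis.repr (Chebyshev.S ℤ n) k.toNat else 0 := by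
    rw [chebyshevBasis_repr_S, ht, Finsupp.single_apply, Finsupp.single_apply]
    split_ifs <;> omega
  rcases lt_trichotomy j (-1) with h | rfl | h
  · obtain ⟨m, hm⟩ := Int.eq_ofNat_of_zero_le (show 0 ≤ -j - 2 by omega)
    rw [Lb, if_neg (by omega), if_neg (by omega), hm, Finsupp.neg_apply, hnat m,
      show j = -m - 2 by omega, Chebyshev.S_neg_sub_two]
    split_ifs <;> simp
  · simp [Lb]
  · lift j to ℕ using (by omega)
    rw [Lb, if_pos (by omega), hnat]

theorem Lmap_apply (f : V) (k : ℤ) :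
    Lmap f k = if 0 ≤ k then chebyshevBasis.repr (toChebyshev f) k.toNat else 0 := by
  simp only [Lmap, toChebyshev, Finsupp.linearCombination_apply, Finsupp.sum,
    Finsupp.finsetSum_apply, Finsupp.smul_apply, map_sum, map_smul, Lb_apply]
  split_ifs <;> simp

theorem Lmap_nonneg {f : V} (hf : ChebyshevNonneg (toChebyshev f)) (k : ℤ) : 0 ≤ Lmap f k := by
  rw [Lmap_apply]
  split_ifs
  exacts [hf _, le_rfl]

theorem toChebyshev_eZ (n : ℕ) : ∃ (D : ℤ[X]) (m : ℕ), ChebyshevNonneg D ∧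
    toChebyshev (eZ n).1 = D * Chebyshev.S ℤ ((m + 1 : ℕ) : ℤ) ∧
    toChebyshev (eZ n).2.1 = D * Chebyshev.S ℤ m ∧
    toChebyshev (eZ n).2.2 = D * Chebyshev.S ℤ m := by
  induction n with
  | zero =>
    refine ⟨1, 1, by simpa using chebyshevNonneg_S 0, ?_⟩
    simp [eZ, toChebyshev_ht]
  | succ n ih =>
    obtain ⟨D, m, hD, h₀, h₁, h₂⟩ := ih
    refine ⟨D * D * D * Chebyshev.S ℤ ((m + 1 : ℕ) : ℤ), 2 * m + 1,
      ((hD.mul hD).mul hD).mul (chebyshevNonneg_S _), ?_⟩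
    have hsq := chebyshevS_mul_sub_mul ((m + 1 : ℕ) : ℤ) ((m + 1 : ℕ) : ℤ)
    have hmid := chebyshevS_mul_sub_mul ((m + 1 : ℕ) : ℤ) m
    have hrec := Chebyshev.S_add_one ℤ (m : ℤ)
    rw [show ((m + 1 : ℕ) : ℤ) - 1 = m by push_cast; ring] at hsq hmid
    rw [show ((m + 1 : ℕ) : ℤ) + ((m + 1 : ℕ) : ℤ) = ((2 * m + 1 + 1 : ℕ) : ℤ) by
      push_cast; ring] at hsq
    rw [show ((m + 1 : ℕ) : ℤ) + m = ((2 * m + 1 : ℕ) : ℤ) by push_cast; ring] at hmid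
    rw [show (m : ℤ) + 1 = ((m + 1 : ℕ) : ℤ) by push_cast; ring] at hrec
    simp only [eZ, map_add, map_sub, toChebyshev_mulV, toChebyshev_ht, Chebyshev.S_one,
      h₀, h₁, h₂, ← hsq, ← hmid]
    refine ⟨by ring, ?_, ?_⟩ <;>
    linear_combination
      D ^ 3 * Chebyshev.S ℤ ((m + 1 : ℕ) : ℤ) * Chebyshev.S ℤ m * hrec

end ChebyshevPositivity

/-- For every `n ≥ 0` and every `i ∈ {−1, 0, 1}`, every coefficient of `L(ẽ(n, i, 0))`
in the basis `(h̃_j)` is nonnegative. -/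
theorem stmt15 (n : ℕ) (i : ℤ) (hi : i ∈ ({-1, 0, 1} : Set ℤ)) :
    ∀ j : ℤ, 0 ≤ Lmap (etilde0 n i) j := by
  obtain ⟨D, m, hD, h₀, h₁, h₂⟩ := toChebyshev_eZ n
  refine Lmap_nonneg ?_
  unfold etilde0
  split_ifs
  · exact h₀ ▸ hD.mul (chebyshevNonneg_S _)
  · exact h₁ ▸ hD.mul (chebyshevNonneg_S _)
  · exact h₂ ▸ hD.mul (chebyshevNonneg_S _)
end
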